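/- Let F : ℝ^{m×n} → ℝ^{m×n}, let A : [0, h] → ℝ^{m×n} be differentiable with A′(t) = F(A(t)) for all t ∈ [0, h]. Let Q ∈ ℝ^{m×k₁} and W ∈ ℝ^{n×k₂} have orthonormal columns (QᵀQ = I, WᵀW = I). Assume that for every t ∈ [0, h] the column space of A(t) is contained in the column space of Q and the column space of A(t)ᵀ is contained in the column space of W. Then the curve D : [0, h] → ℝ^{k₁×k₂} defined by D(t) = Qᵀ A(t) W satisfies D(0) = Qᵀ A(0) W and D′(t) = Qᵀ F(Q D(t) Wᵀ) W for all t ∈ [0, h]; that is, D is a solution of the D-step differential equation of the dynamical generalized Nyström method. -/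

import Mathlib

open Matrix

attribute [local instance] Matrix.frobeniusNormedAddCommGroup Matrix.frobeniusNormedSpace

/-- Orthogonal projection onto the column space of `Q` fixes every matrix whose column space
lies in that of `Q`. -/
theorem mul_transpose_mul_eq_self_of_range_le {R l k p : Type*} [CommRing R] [Fintype l]
    [Fintype k] [DecidableEq k] [Fintype p] {Q : Matrix l k R} {M : Matrix l p R}
    (hQ : Qᵀ * Q = 1) (hM : LinearMap.range M.mulVecLin ≤ LinearMap.range Q.mulVecLin) :
    Q * (Qᵀ * M) = M := by
  refine Matrix.mulVec_injective (funext fun v => ?_)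
  obtain ⟨w, hw⟩ := hM ⟨v, rfl⟩
  simp only [mulVecLin_apply] at hw
  rw [← mulVec_mulVec, ← mulVec_mulVec, ← hw, mulVec_mulVec w Qᵀ Q, hQ, one_mulVec]

/-- Multiplication by constant matrices on both sides commutes with differentiation. -/
theorem hasDerivAt_const_mul_mul_const {l m n p : Type*} [Fintype l] [Fintype m] [Fintype n]
    [Fintype p] {A : ℝ → Matrix m n ℝ} {A' : Matrix m n ℝ} {t : ℝ}
    (P : Matrix l m ℝ) (R : Matrix n p ℝ) (hA : HasDerivAt A A' t) :
    HasDerivAt (fun s => P * A s * R) (P * A' * R) t := by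
  let L : Matrix m n ℝ →ₗ[ℝ] Matrix l p ℝ :=
    { toFun := fun X => P * X * R
      map_add' := fun X Y => by rw [Matrix.mul_add, Matrix.add_mul]
      map_smul' := fun c X => by simp }
  exact (LinearMap.toContinuousLinearMap L).hasFDerivAt.comp_hasDerivAt t hA

/-- If `A′(t) = F(A(t))` on `[0, h]`, `Q` and `W` have orthonormal columns, the column
space of `A(t)` is contained in that of `Q` and the column space of `A(t)ᵀ` is contained
in that of `W` for all `t ∈ [0, h]`, then `D(t) = Qᵀ A(t) W` satisfies
`D(0) = Qᵀ A(0) W` and `D′(t) = Qᵀ F(Q D(t) Wᵀ) W`, i.e. `D` solves the D-step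
differential equation of the dynamical generalized Nyström method. -/
theorem stmt_13 {m n k₁ k₂ : ℕ} {h : ℝ}
    (F : Matrix (Fin m) (Fin n) ℝ → Matrix (Fin m) (Fin n) ℝ)
    (A : ℝ → Matrix (Fin m) (Fin n) ℝ)
    (Q : Matrix (Fin m) (Fin k₁) ℝ) (W : Matrix (Fin n) (Fin k₂) ℝ)
    (hQ : Qᵀ * Q = 1) (hW : Wᵀ * W = 1)
    (hA : ∀ t ∈ Set.Icc (0 : ℝ) h, HasDerivAt A (F (A t)) t)
    (hrange : ∀ t ∈ Set.Icc (0 : ℝ) h,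
      LinearMap.range (A t).mulVecLin ≤ LinearMap.range Q.mulVecLin)
    (hcorange : ∀ t ∈ Set.Icc (0 : ℝ) h,
      LinearMap.range (A t)ᵀ.mulVecLin ≤ LinearMap.range W.mulVecLin) :
    (fun t => Qᵀ * A t * W) 0 = Qᵀ * A 0 * W ∧
      ∀ t ∈ Set.Icc (0 : ℝ) h,
        HasDerivAt (fun t => Qᵀ * A t * W)
          (Qᵀ * F (Q * (Qᵀ * A t * W) * Wᵀ) * W) t := by
  refine ⟨rfl, fun t ht => ?_⟩
  have hproj : Q * (Qᵀ * A t * W) * Wᵀ = A t := by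
    have hrow := congrArg transpose
      (mul_transpose_mul_eq_self_of_range_le hW (hcorange t ht))
    simp only [transpose_mul, transpose_transpose] at hrow
    rw [← Matrix.mul_assoc Q, mul_transpose_mul_eq_self_of_range_le hQ (hrange t ht), hrow]
  rw [hproj]
  exact hasDerivAt_const_mul_mul_const Qᵀ W (hA t ht)
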